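/- (Dranishnikov–Konyagin–Protasov) Let 𝒜 = {A_1, …, A_r} be an irreducible finite set of real m×m matrices and let ρ > 0. Then ρ = ρ(𝒜) if and only if there exists a centrally symmetric (S = −S) compact convex set S ⊂ ℝ^m with nonempty interior such that ρ·S = conv(∪_{i=1}^r A_i(S)), where ρ·S = {ρ·x : x ∈ S} and conv denotes the convex hull. -/

import Mathlib

open Matrix Filter Topology Bornology Pointwise

/-- `N` is a norm on `ℝ^m`: nonnegative, definite, absolutely homogeneous, subadditive. -/
def IsNorm {m : ℕ} (N : (Fin m → ℝ) → ℝ) : Prop :=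
  (∀ x, 0 ≤ N x) ∧ (∀ x, N x = 0 → x = 0) ∧
    (∀ (t : ℝ) (x), N (t • x) = |t| * N x) ∧ (∀ x y, N (x + y) ≤ N x + N y)

/-- `N` is a seminorm on `ℝ^m`. -/
def IsSeminorm {m : ℕ} (N : (Fin m → ℝ) → ℝ) : Prop :=
  (∀ x, 0 ≤ N x) ∧
    (∀ (t : ℝ) (x), N (t • x) = |t| * N x) ∧ (∀ x y, N (x + y) ≤ N x + N y)

/-- The family `A` is irreducible: the matrices have no common invariant subspace
other than `⊥` and `⊤`. -/
def IsIrreducibleFamily {m r : ℕ} (A : Fin r → Matrix (Fin m) (Fin m) ℝ) : Prop :=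
  ∀ W : Submodule ℝ (Fin m → ℝ), (∀ i, ∀ x ∈ W, (A i).mulVec x ∈ W) → W = ⊥ ∨ W = ⊤

/-- The operator norm of a matrix acting on `ℝ^m` (with its sup norm). -/
noncomputable def matNorm {m : ℕ} (M : Matrix (Fin m) (Fin m) ℝ) : ℝ :=
  ‖LinearMap.toContinuousLinearMap M.mulVecLin‖

/-- The joint spectral radius of the family `A`:
`limsup_n (max over words of length n of the norm of the product)^(1/n)`. -/
noncomputable def jsr {m r : ℕ} (A : Fin r → Matrix (Fin m) (Fin m) ℝ) : ℝ :=
  Filter.atTop.limsup fun n : ℕ =>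
    (⨆ w : Fin n → Fin r, matNorm (List.ofFn fun k => A (w k)).prod) ^ (1 / (n : ℝ))

/-- `maxA A N x = max_i N (A_i x)`. -/
noncomputable def maxA {m r : ℕ} (A : Fin r → Matrix (Fin m) (Fin m) ℝ)
    (N : (Fin m → ℝ) → ℝ) (x : Fin m → ℝ) : ℝ :=
  ⨆ i, N ((A i).mulVec x)

/-- `ρ⁺ = max_{x ≠ 0} (max_i N (A_i x)) / N x`. -/
noncomputable def rhoSup {m r : ℕ} (A : Fin r → Matrix (Fin m) (Fin m) ℝ)
    (N : (Fin m → ℝ) → ℝ) : ℝ :=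
  sSup ((fun x => maxA A N x / N x) '' {x | x ≠ 0})

/-- `ρ⁻ = min_{x ≠ 0} (max_i N (A_i x)) / N x`. -/
noncomputable def rhoInf {m r : ℕ} (A : Fin r → Matrix (Fin m) (Fin m) ℝ)
    (N : (Fin m → ℝ) → ℝ) : ℝ :=
  sInf ((fun x => maxA A N x / N x) '' {x | x ≠ 0})

/-- An averaging function: continuous on positives, `γ t t = t`, and strictly
between `min` and `max` off the diagonal. -/
def IsAveraging (γ : ℝ → ℝ → ℝ) : Prop :=
  ContinuousOn (fun p : ℝ × ℝ => γ p.1 p.2) {p | 0 < p.1 ∧ 0 < p.2} ∧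
    (∀ t, 0 < t → γ t t = t) ∧
    ∀ t s, 0 < t → 0 < s → t ≠ s → min t s < γ t s ∧ γ t s < max t s

/-- The max-relaxation iteration: `‖x‖_{n+1} = max (‖x‖_n, γ_n⁻¹ max_i ‖A_i x‖_n)`
where `γ_n = γ (ρ⁻_n, ρ⁺_n)`. -/
noncomputable def iterN {m r : ℕ} (A : Fin r → Matrix (Fin m) (Fin m) ℝ)
    (γ : ℝ → ℝ → ℝ) (N0 : (Fin m → ℝ) → ℝ) : ℕ → (Fin m → ℝ) → ℝ
  | 0 => N0
  | n + 1 => fun x =>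
      max (iterN A γ N0 n x)
        ((γ (rhoInf A (iterN A γ N0 n)) (rhoSup A (iterN A γ N0 n)))⁻¹ *
          maxA A (iterN A γ N0 n) x)

/-- The normalized norms `‖x‖°_n = ‖x‖_n / ‖e‖_n` of the max-relaxation iteration
(for `n = 0` this equals `‖x‖_0` since `‖e‖_0 = 1`). -/
noncomputable def iterNnorm {m r : ℕ} (A : Fin r → Matrix (Fin m) (Fin m) ℝ)
    (γ : ℝ → ℝ → ℝ) (N0 : (Fin m → ℝ) → ℝ) (e : Fin m → ℝ) (n : ℕ) :
    (Fin m → ℝ) → ℝ :=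
  fun x => iterN A γ N0 n x / iterN A γ N0 n e

/-- `e⁺(N, N') = max_{x ≠ 0} N x / N' x`. -/
noncomputable def ePlus {m : ℕ} (N N' : (Fin m → ℝ) → ℝ) : ℝ :=
  sSup ((fun x => N x / N' x) '' {x | x ≠ 0})

/-- `e⁻(N, N') = min_{x ≠ 0} N x / N' x`. -/
noncomputable def eMinus {m : ℕ} (N N' : (Fin m → ℝ) → ℝ) : ℝ :=
  sInf ((fun x => N x / N' x) '' {x | x ≠ 0})

/-- The eccentricity of the norm `N` with respect to the norm `N'`. -/
noncomputable def ecc {m : ℕ} (N N' : (Fin m → ℝ) → ℝ) : ℝ :=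
  ePlus N N' / eMinus N N'

section MatNorm

variable {m : ℕ}

theorem matNorm_nonneg (M : Matrix (Fin m) (Fin m) ℝ) : 0 ≤ matNorm M := norm_nonneg _

theorem norm_mulVec_le_matNorm (M : Matrix (Fin m) (Fin m) ℝ) (x : Fin m → ℝ) :
    ‖M *ᵥ x‖ ≤ matNorm M * ‖x‖ :=
  (LinearMap.toContinuousLinearMap M.mulVecLin).le_opNorm x

theorem matNorm_le {M : Matrix (Fin m) (Fin m) ℝ} {C : ℝ} (hC : 0 ≤ C)
    (h : ∀ x, ‖M *ᵥ x‖ ≤ C * ‖x‖) : matNorm M ≤ C :=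
  ContinuousLinearMap.opNorm_le_bound _ hC h

theorem matNorm_mul_le (M M' : Matrix (Fin m) (Fin m) ℝ) :
    matNorm (M * M') ≤ matNorm M * matNorm M' := by
  refine matNorm_le (mul_nonneg (matNorm_nonneg _) (matNorm_nonneg _)) fun x => ?_
  rw [← Matrix.mulVec_mulVec, mul_assoc]
  exact (norm_mulVec_le_matNorm _ _).trans
    (mul_le_mul_of_nonneg_left (norm_mulVec_le_matNorm _ _) (matNorm_nonneg _))

theorem matNorm_one_le : matNorm (1 : Matrix (Fin m) (Fin m) ℝ) ≤ 1 :=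
  matNorm_le zero_le_one fun x => by simp

theorem matNorm_smul_le (t : ℝ) (M : Matrix (Fin m) (Fin m) ℝ) :
    matNorm (t • M) ≤ |t| * matNorm M := by
  refine matNorm_le (mul_nonneg (abs_nonneg _) (matNorm_nonneg _)) fun x => ?_
  rw [Matrix.smul_mulVec, norm_smul, Real.norm_eq_abs, mul_assoc]
  exact mul_le_mul_of_nonneg_left (norm_mulVec_le_matNorm _ _) (abs_nonneg _)

theorem abs_entry_le_matNorm (M : Matrix (Fin m) (Fin m) ℝ) (i j : Fin m) :
    |M i j| ≤ matNorm M := by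
  have h := norm_mulVec_le_matNorm M (Pi.single j 1)
  rw [Pi.norm_single, norm_one, mul_one, Matrix.mulVec_single_one] at h
  exact (norm_le_pi_norm (M.col j) i).trans h

theorem matNorm_le_of_entry_le {M : Matrix (Fin m) (Fin m) ℝ} {C : ℝ} (hC : 0 ≤ C)
    (h : ∀ i j, |M i j| ≤ C) : matNorm M ≤ m * C := by
  refine matNorm_le (by positivity) fun x => ?_
  refine (pi_norm_le_iff_of_nonneg (by positivity)).2 fun i => ?_
  calc ‖(M *ᵥ x) i‖ ≤ ∑ j, ‖M i j * x j‖ := norm_sum_le Finset.univ fun j => M i j * x j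
    _ ≤ ∑ _j : Fin m, C * ‖x‖ := by
        refine Finset.sum_le_sum fun j _ => ?_
        rw [norm_mul]
        exact mul_le_mul (h i j) (norm_le_pi_norm x j) (norm_nonneg _) hC
    _ = m * C * ‖x‖ := by simp [mul_assoc]

theorem matNorm_transpose_le (M : Matrix (Fin m) (Fin m) ℝ) : matNorm Mᵀ ≤ m * matNorm M :=
  matNorm_le_of_entry_le (matNorm_nonneg _) fun i j => abs_entry_le_matNorm M j i

theorem abs_dotProduct_le (x y : Fin m → ℝ) : |x ⬝ᵥ y| ≤ m * ‖x‖ * ‖y‖ := by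
  calc |x ⬝ᵥ y| ≤ ∑ j, |x j * y j| := Finset.abs_sum_le_sum_abs _ _
    _ ≤ ∑ _j : Fin m, ‖x‖ * ‖y‖ := by
        refine Finset.sum_le_sum fun j _ => ?_
        rw [abs_mul]
        exact mul_le_mul (norm_le_pi_norm x j) (norm_le_pi_norm y j) (abs_nonneg _)
          (norm_nonneg _)
    _ = m * ‖x‖ * ‖y‖ := by simp [mul_assoc]

end MatNorm

section JointSpectralRadius

variable {m r : ℕ} (A : Fin r → Matrix (Fin m) (Fin m) ℝ)

/-- The largest norm of a product of `n` members of the family. -/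
noncomputable def maxProdNorm (n : ℕ) : ℝ :=
  ⨆ w : Fin n → Fin r, matNorm (List.ofFn fun k => A (w k)).prod

theorem jsr_eq_limsup : jsr A = limsup (fun n : ℕ => maxProdNorm A n ^ (1 / (n : ℝ))) atTop := rfl

theorem maxProdNorm_nonneg (n : ℕ) : 0 ≤ maxProdNorm A n :=
  Real.iSup_nonneg fun _ => matNorm_nonneg _

variable {A}

theorem matNorm_prod_le_maxProdNorm (l : List (Fin r)) :
    matNorm (l.map A).prod ≤ maxProdNorm A l.length := by
  have h := le_ciSup (Set.finite_range fun w : Fin l.length → Fin r =>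
    matNorm (List.ofFn fun k => A (w k)).prod).bddAbove l.get
  have e : (List.ofFn fun k => A (l.get k)) = l.map A := by
    rw [← Function.comp_def A, ← List.map_ofFn, List.ofFn_get]
  rwa [e] at h

theorem maxProdNorm_le {n : ℕ} {C : ℝ} (hC : 0 ≤ C)
    (h : ∀ l : List (Fin r), l.length = n → matNorm (l.map A).prod ≤ C) :
    maxProdNorm A n ≤ C := by
  refine Real.iSup_le (fun w => ?_) hC
  have := h (List.ofFn w) (List.length_ofFn)
  rwa [List.map_ofFn] at this

theorem exists_matNorm_prod_le_pow (A : Fin r → Matrix (Fin m) (Fin m) ℝ) :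
    ∃ K : ℝ, 0 < K ∧ ∀ l : List (Fin r), matNorm (l.map A).prod ≤ K ^ l.length := by
  refine ⟨1 + ∑ i, matNorm (A i), by
    have := Finset.sum_nonneg fun i (_ : i ∈ Finset.univ) => matNorm_nonneg (A i)
    linarith, fun l => ?_⟩
  induction l with
  | nil => simpa using matNorm_one_le
  | cons i l ih =>
    rw [List.map_cons, List.prod_cons, List.length_cons, pow_succ']
    have hi : matNorm (A i) ≤ 1 + ∑ i, matNorm (A i) := by
      have := Finset.single_le_sum (fun i _ => matNorm_nonneg (A i)) (Finset.mem_univ i)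
      linarith
    exact (matNorm_mul_le _ _).trans
      (mul_le_mul hi ih (matNorm_nonneg _) ((matNorm_nonneg _).trans hi))

theorem tendsto_const_mul_pow_rpow_inv {c t : ℝ} (hc : 0 < c) (ht : 0 ≤ t) :
    Tendsto (fun n : ℕ => (c * t ^ n) ^ (1 / (n : ℝ))) atTop (𝓝 t) := by
  have h1 : Tendsto (fun n : ℕ => c ^ (1 / (n : ℝ)) * t) atTop (𝓝 (c ^ (0 : ℝ) * t)) :=
    ((Real.continuousAt_const_rpow hc.ne').tendsto.comp
      tendsto_one_div_atTop_nhds_zero_nat).mul_const t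
  rw [Real.rpow_zero, one_mul] at h1
  refine h1.congr' ?_
  filter_upwards [eventually_ne_atTop 0] with n hn
  rw [Real.mul_rpow hc.le (pow_nonneg ht n), one_div, Real.pow_rpow_inv_natCast ht hn]

theorem isCoboundedUnder_maxProdNorm :
    IsCoboundedUnder (· ≤ ·) atTop fun n : ℕ => maxProdNorm A n ^ (1 / (n : ℝ)) :=
  isCoboundedUnder_le_of_le (x := 0) atTop fun n =>
    Real.rpow_nonneg (maxProdNorm_nonneg A n) _

theorem isBoundedUnder_maxProdNorm :
    IsBoundedUnder (· ≤ ·) atTop fun n : ℕ => maxProdNorm A n ^ (1 / (n : ℝ)) := by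
  obtain ⟨K, hK, h⟩ := exists_matNorm_prod_le_pow A
  refine (tendsto_const_mul_pow_rpow_inv one_pos hK.le).isBoundedUnder_le.mono_le
    (Eventually.of_forall fun n => ?_)
  refine Real.rpow_le_rpow (maxProdNorm_nonneg A n) ?_ (by positivity)
  rw [one_mul]
  exact maxProdNorm_le (by positivity) fun l hl => hl ▸ h l

theorem jsr_le_of_matNorm_prod_le {C t : ℝ} (hC : 0 < C) (ht : 0 ≤ t)
    (h : ∀ l : List (Fin r), matNorm (l.map A).prod ≤ C * t ^ l.length) : jsr A ≤ t := by
  have hlim := tendsto_const_mul_pow_rpow_inv hC ht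
  rw [jsr_eq_limsup, ← hlim.limsup_eq]
  refine limsup_le_limsup (Eventually.of_forall fun n => ?_) isCoboundedUnder_maxProdNorm
    hlim.isBoundedUnder_le
  exact Real.rpow_le_rpow (maxProdNorm_nonneg A n)
    (maxProdNorm_le (by positivity) fun l hl => hl ▸ h l) (by positivity)

theorem le_jsr_of_le_matNorm_prod {c t : ℝ} (hc : 0 < c) (ht : 0 ≤ t)
    (h : ∀ n, ∃ l : List (Fin r), l.length = n ∧ c * t ^ n ≤ matNorm (l.map A).prod) :
    t ≤ jsr A := by
  have hlim := tendsto_const_mul_pow_rpow_inv hc ht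
  rw [jsr_eq_limsup, ← hlim.limsup_eq]
  refine limsup_le_limsup (Eventually.of_forall fun n => ?_)
    hlim.isCoboundedUnder_le isBoundedUnder_maxProdNorm
  obtain ⟨l, rfl, hl⟩ := h n
  exact Real.rpow_le_rpow (by positivity) (hl.trans (matNorm_prod_le_maxProdNorm l))
    (by positivity)

theorem exists_matNorm_prod_le_of_jsr_lt {t : ℝ} (ht : 0 < t) (h : jsr A < t) :
    ∃ C : ℝ, 0 < C ∧ ∀ l : List (Fin r), matNorm (l.map A).prod ≤ C * t ^ l.length := by
  rw [jsr_eq_limsup] at h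
  obtain ⟨n₀, hn₀⟩ := eventually_atTop.1 (eventually_lt_of_limsup_lt h isBoundedUnder_maxProdNorm)
  obtain ⟨K, hK, hKl⟩ := exists_matNorm_prod_le_pow A
  have hsum : 0 ≤ ∑ k ∈ Finset.range (n₀ + 1), (K / t) ^ k :=
    Finset.sum_nonneg fun k _ => by positivity
  refine ⟨1 + ∑ k ∈ Finset.range (n₀ + 1), (K / t) ^ k, by linarith, fun l => ?_⟩
  have htl : 0 < t ^ l.length := by positivity
  rcases le_or_gt l.length n₀ with hl | hl
  · have h1 : (K / t) ^ l.length ≤ ∑ k ∈ Finset.range (n₀ + 1), (K / t) ^ k :=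
      Finset.single_le_sum (f := fun k => (K / t) ^ k) (fun k _ => by positivity)
        (Finset.mem_range.2 (Nat.lt_succ_of_le hl))
    refine (hKl l).trans ?_
    calc K ^ l.length = (K / t) ^ l.length * t ^ l.length := by
          rw [← mul_pow, div_mul_cancel₀ _ ht.ne']
      _ ≤ _ := mul_le_mul_of_nonneg_right (by linarith) htl.le
  · have h1 := hn₀ l.length hl.le
    have hne : l.length ≠ 0 := by omega
    have h2 : maxProdNorm A l.length ≤ t ^ l.length := by
      have := pow_le_pow_left₀ (Real.rpow_nonneg (maxProdNorm_nonneg A l.length) _) h1.le l.length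
      rwa [one_div, Real.rpow_inv_natCast_pow (maxProdNorm_nonneg A _) hne] at this
    refine (matNorm_prod_le_maxProdNorm l).trans (h2.trans ?_)
    nlinarith

/-- If, for some `n ≠ 0`, all products of length `n` are at most `δ * t ^ n` with `δ < 1`,
then the joint spectral radius is smaller than `t`. -/
theorem jsr_lt_of_matNorm_prod_lt {t δ : ℝ} (ht : 0 < t) (hδ : 0 < δ) (hδ1 : δ < 1) {n : ℕ}
    (hn : n ≠ 0) (h : ∀ l : List (Fin r), l.length = n → matNorm (l.map A).prod ≤ δ * t ^ n) :
    jsr A < t := by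
  obtain ⟨K, hK, hKl⟩ := exists_matNorm_prod_le_pow A
  set μ : ℝ := δ ^ ((n : ℝ)⁻¹) * t with hμ
  have hδn : 0 < δ ^ ((n : ℝ)⁻¹) := Real.rpow_pos_of_pos hδ _
  have hμ0 : 0 < μ := mul_pos hδn ht
  have hμt : μ < t := by
    have : δ ^ ((n : ℝ)⁻¹) < 1 := Real.rpow_lt_one hδ.le hδ1 (by positivity)
    nlinarith
  have hμn : μ ^ n = δ * t ^ n := by
    rw [hμ, mul_pow, Real.rpow_inv_natCast_pow hδ.le hn]
  have hsum : 0 ≤ ∑ k ∈ Finset.range n, (K / μ) ^ k :=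
    Finset.sum_nonneg fun k _ => by positivity
  refine (jsr_le_of_matNorm_prod_le (C := 1 + ∑ k ∈ Finset.range n, (K / μ) ^ k) (by linarith)
    hμ0.le fun l => ?_).trans_lt hμt
  induction hk : l.length using Nat.strong_induction_on generalizing l with
  | _ k ih =>
    subst hk
    have hμl : 0 < μ ^ l.length := by positivity
    rcases lt_or_ge l.length n with hl | hl
    · have h1 : (K / μ) ^ l.length ≤ ∑ k ∈ Finset.range n, (K / μ) ^ k :=
        Finset.single_le_sum (f := fun k => (K / μ) ^ k) (fun k _ => by positivity)
          (Finset.mem_range.2 hl)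
      refine (hKl l).trans ?_
      calc K ^ l.length = (K / μ) ^ l.length * μ ^ l.length := by
            rw [← mul_pow, div_mul_cancel₀ _ hμ0.ne']
        _ ≤ _ := mul_le_mul_of_nonneg_right (by linarith) hμl.le
    · have h1 := h (l.take n) (by simpa using hl)
      have h2 := ih (l.drop n).length (by rw [List.length_drop]; omega) (l.drop n) rfl
      have e : (l.map A).prod = ((l.take n).map A).prod * ((l.drop n).map A).prod := by
        rw [← List.prod_append, ← List.map_append, List.take_append_drop]
      rw [e]
      refine (matNorm_mul_le _ _).trans ((mul_le_mul h1 h2 (matNorm_nonneg _)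
        (by positivity)).trans_eq ?_)
      rw [← hμn, mul_left_comm, ← pow_add, List.length_drop, Nat.add_sub_cancel' hl]

end JointSpectralRadius

section InvariantNorm

variable {m r : ℕ} {B : Fin r → Matrix (Fin m) (Fin m) ℝ}

theorem prod_map_append_singleton_mulVec (l : List (Fin r)) (i : Fin r) (x : Fin m → ℝ) :
    ((l ++ [i]).map B).prod *ᵥ x = (l.map B).prod *ᵥ (B i *ᵥ x) := by
  simp [Matrix.mulVec_mulVec]

/-- The subspace of vectors whose orbit under all products of the family is bounded. -/
def boundedOrbits (B : Fin r → Matrix (Fin m) (Fin m) ℝ) : Submodule ℝ (Fin m → ℝ) where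
  carrier := {x | ∃ C : ℝ, ∀ l : List (Fin r), ‖(l.map B).prod *ᵥ x‖ ≤ C}
  zero_mem' := ⟨0, fun l => by simp⟩
  add_mem' := by
    rintro x y ⟨C, hC⟩ ⟨D, hD⟩
    refine ⟨C + D, fun l => ?_⟩
    rw [Matrix.mulVec_add]
    exact (norm_add_le _ _).trans (add_le_add (hC l) (hD l))
  smul_mem' := by
    rintro t x ⟨C, hC⟩
    refine ⟨‖t‖ * C, fun l => ?_⟩
    rw [Matrix.mulVec_smul, norm_smul]
    exact mul_le_mul_of_nonneg_left (hC l) (norm_nonneg t)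

theorem exists_matNorm_prod_le_of_boundedOrbits_eq_top (h : boundedOrbits B = ⊤) :
    ∃ K : ℝ, ∀ l : List (Fin r), matNorm (l.map B).prod ≤ K := by
  have h' : ∀ j, ∃ C : ℝ, ∀ l : List (Fin r), ‖(l.map B).prod *ᵥ Pi.single j 1‖ ≤ C := fun j =>
    (h ▸ Submodule.mem_top : (Pi.single j 1 : Fin m → ℝ) ∈ boundedOrbits B)
  choose C hC using h'
  refine ⟨m * ∑ j, C j, fun l => ?_⟩
  have hC0 : ∀ j, 0 ≤ C j := fun j => (norm_nonneg _).trans (hC j [])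
  refine matNorm_le_of_entry_le (Finset.sum_nonneg fun j _ => hC0 j) fun i j => ?_
  have h1 := hC j l
  rw [Matrix.mulVec_single_one] at h1
  exact ((norm_le_pi_norm ((l.map B).prod.col j) i).trans h1).trans
    (Finset.single_le_sum (fun j _ => hC0 j) (Finset.mem_univ j))

/-- If no nonzero vector has a bounded orbit, then products of bounded length double the norm
of any given vector. -/
theorem exists_uniform_doubling (h : boundedOrbits B = ⊥) :
    ∃ k : ℕ, ∀ x : Fin m → ℝ, ∃ l : List (Fin r), l.length ≤ k ∧
      2 * ‖x‖ ≤ ‖(l.map B).prod *ᵥ x‖ := by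
  have hcover : Metric.sphere (0 : Fin m → ℝ) 1 ⊆
      ⋃ l : List (Fin r), {x | 2 < ‖(l.map B).prod *ᵥ x‖} := by
    intro x hx
    by_contra hcon
    simp only [Set.mem_iUnion, Set.mem_ofPred_eq, not_exists, not_lt] at hcon
    have : x ∈ boundedOrbits B := ⟨2, hcon⟩
    rw [h, Submodule.mem_bot] at this
    simp [this] at hx
  obtain ⟨t, ht⟩ := (isCompact_sphere (0 : Fin m → ℝ) 1).elim_finite_subcover _
    (fun l => isOpen_lt continuous_const
      ((Continuous.matrix_mulVec continuous_const continuous_id).norm)) hcover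
  refine ⟨t.sup List.length, fun x => ?_⟩
  rcases eq_or_ne x 0 with rfl | hx
  · exact ⟨[], by simp, by simp⟩
  have hx' : 0 < ‖x‖ := norm_pos_iff.2 hx
  have hs : ‖x‖⁻¹ • x ∈ Metric.sphere (0 : Fin m → ℝ) 1 := by
    simp [norm_smul, hx'.ne']
  obtain ⟨l, hl, hlt⟩ := Set.mem_iUnion₂.1 (ht hs)
  refine ⟨l, Finset.le_sup (f := List.length) hl, ?_⟩
  simp only [Set.mem_ofPred_eq, Matrix.mulVec_smul, norm_smul, norm_inv, norm_norm] at hlt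
  rw [inv_mul_eq_div, lt_div_iff₀ hx'] at hlt
  exact hlt.le

/-- An irreducible family with products growing slower than any exponential is product
bounded. -/
theorem exists_matNorm_prod_le_of_irreducible (hm : 0 < m) (hB : IsIrreducibleFamily B)
    (hgrowth : ∀ t : ℝ, 1 < t →
      ∃ C : ℝ, ∀ l : List (Fin r), matNorm (l.map B).prod ≤ C * t ^ l.length) :
    ∃ K : ℝ, ∀ l : List (Fin r), matNorm (l.map B).prod ≤ K := by
  have hinv : ∀ i, ∀ x ∈ boundedOrbits B, (B i).mulVec x ∈ boundedOrbits B := by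
    rintro i x ⟨C, hC⟩
    exact ⟨C, fun l => by rw [← prod_map_append_singleton_mulVec]; exact hC _⟩
  rcases hB _ hinv with h | h
  swap
  · exact exists_matNorm_prod_le_of_boundedOrbits_eq_top h
  exfalso
  obtain ⟨k, hk⟩ := exists_uniform_doubling h
  set x₀ : Fin m → ℝ := Pi.single ⟨0, hm⟩ 1
  have hx₀ : ‖x₀‖ = 1 := by rw [Pi.norm_single, norm_one]
  have hiter : ∀ n : ℕ, ∃ l : List (Fin r), l.length ≤ n * (k + 1) ∧
      2 ^ n ≤ ‖(l.map B).prod *ᵥ x₀‖ := by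
    intro n
    induction n with
    | zero => exact ⟨[], by simp, by simp [hx₀]⟩
    | succ n ih =>
      obtain ⟨l, hl, hl2⟩ := ih
      obtain ⟨l', hl', hl2'⟩ := hk ((l.map B).prod *ᵥ x₀)
      refine ⟨l' ++ l, by rw [List.length_append, add_one_mul]; omega, ?_⟩
      rw [List.map_append, List.prod_append, ← Matrix.mulVec_mulVec, pow_succ']
      linarith
  set t : ℝ := (3 / 2 : ℝ) ^ (((k + 1 : ℕ) : ℝ)⁻¹)
  have ht : 1 < t := Real.one_lt_rpow (by norm_num) (by positivity)
  have htk : t ^ (k + 1) = 3 / 2 := Real.rpow_inv_natCast_pow (by norm_num) (by omega)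
  obtain ⟨C, hC⟩ := hgrowth t ht
  have hC0 : 0 ≤ C := by simpa using (matNorm_nonneg _).trans (hC [])
  obtain ⟨n, hn⟩ := pow_unbounded_of_one_lt C (by norm_num : (1 : ℝ) < 4 / 3)
  obtain ⟨l, hl, hl2⟩ := hiter n
  have h1 : (2 : ℝ) ^ n ≤ C * (3 / 2) ^ n := by
    calc (2 : ℝ) ^ n ≤ matNorm (l.map B).prod * ‖x₀‖ := hl2.trans (norm_mulVec_le_matNorm _ _)
      _ ≤ C * t ^ l.length := by rw [hx₀, mul_one]; exact hC l
      _ ≤ C * t ^ (n * (k + 1)) :=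
          mul_le_mul_of_nonneg_left (pow_le_pow_right₀ ht.le hl) hC0
      _ = C * (3 / 2) ^ n := by rw [mul_comm n, pow_mul, htk]
  have h2 : (2 : ℝ) ^ n = (4 / 3) ^ n * (3 / 2) ^ n := by rw [← mul_pow]; norm_num
  rw [h2] at h1
  exact absurd (le_of_mul_le_mul_right h1 (by positivity)) (not_le.2 hn)

/-- The supremum of the norms of the images of `x` under products of length at least `n`. -/
noncomputable def tailSup (B : Fin r → Matrix (Fin m) (Fin m) ℝ) (n : ℕ) (x : Fin m → ℝ) : ℝ :=
  ⨆ l : {l : List (Fin r) // n ≤ l.length}, ‖(l.1.map B).prod *ᵥ x‖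

theorem tailSup_nonneg (n : ℕ) (x : Fin m → ℝ) : 0 ≤ tailSup B n x :=
  Real.iSup_nonneg fun _ => norm_nonneg _

theorem tailSup_le {n : ℕ} {x : Fin m → ℝ} {C : ℝ} (hC : 0 ≤ C)
    (h : ∀ l : List (Fin r), n ≤ l.length → ‖(l.map B).prod *ᵥ x‖ ≤ C) : tailSup B n x ≤ C :=
  Real.iSup_le (fun l => h l.1 l.2) hC

theorem tailSup_smul (n : ℕ) (t : ℝ) (x : Fin m → ℝ) :
    tailSup B n (t • x) = |t| * tailSup B n x := by
  simp only [tailSup, Matrix.mulVec_smul, norm_smul, Real.norm_eq_abs,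
    Real.mul_iSup_of_nonneg (abs_nonneg t)]

/-- The upper limit of the norms of the images of `x` under long products. -/
noncomputable def limitNorm (B : Fin r → Matrix (Fin m) (Fin m) ℝ) (x : Fin m → ℝ) : ℝ :=
  ⨅ n, tailSup B n x

theorem limitNorm_le_tailSup (n : ℕ) (x : Fin m → ℝ) : limitNorm B x ≤ tailSup B n x :=
  ciInf_le ⟨0, Set.forall_mem_range.2 fun n => tailSup_nonneg n x⟩ n

theorem limitNorm_nonneg (x : Fin m → ℝ) : 0 ≤ limitNorm B x :=
  le_ciInf fun n => tailSup_nonneg n x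

section ProductBounded

variable {K : ℝ} (hK : ∀ l : List (Fin r), matNorm (l.map B).prod ≤ K)
include hK

theorem le_tailSup {n : ℕ} (x : Fin m → ℝ) {l : List (Fin r)} (hl : n ≤ l.length) :
    ‖(l.map B).prod *ᵥ x‖ ≤ tailSup B n x := by
  refine le_ciSup (f := fun l : {l : List (Fin r) // n ≤ l.length} => ‖(l.1.map B).prod *ᵥ x‖)
    ⟨K * ‖x‖, Set.forall_mem_range.2 fun l => ?_⟩ ⟨l, hl⟩
  exact (norm_mulVec_le_matNorm _ _).trans (mul_le_mul_of_nonneg_right (hK _) (norm_nonneg _))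

theorem tailSup_le_mul_norm (n : ℕ) (x : Fin m → ℝ) : tailSup B n x ≤ K * ‖x‖ :=
  tailSup_le (mul_nonneg ((matNorm_nonneg _).trans (hK [])) (norm_nonneg _)) fun _ _ =>
    (norm_mulVec_le_matNorm _ _).trans (mul_le_mul_of_nonneg_right (hK _) (norm_nonneg _))

theorem antitone_tailSup (x : Fin m → ℝ) : Antitone fun n => tailSup B n x := fun _ _ h =>
  tailSup_le (tailSup_nonneg _ _) fun _ hl => le_tailSup hK x (h.trans hl)

theorem tailSup_add_le (n : ℕ) (x y : Fin m → ℝ) :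
    tailSup B n (x + y) ≤ tailSup B n x + tailSup B n y := by
  refine tailSup_le (add_nonneg (tailSup_nonneg _ _) (tailSup_nonneg _ _)) fun l hl => ?_
  rw [Matrix.mulVec_add]
  exact (norm_add_le _ _).trans (add_le_add (le_tailSup hK x hl) (le_tailSup hK y hl))

theorem tendsto_tailSup (x : Fin m → ℝ) :
    Tendsto (fun n => tailSup B n x) atTop (𝓝 (limitNorm B x)) :=
  tendsto_atTop_ciInf (antitone_tailSup hK x)
    ⟨0, Set.forall_mem_range.2 fun n => tailSup_nonneg n x⟩

theorem isSeminorm_limitNorm : IsSeminorm (limitNorm B) := by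
  refine ⟨limitNorm_nonneg, fun t x => ?_, fun x y => ?_⟩
  · refine tendsto_nhds_unique (tendsto_tailSup hK (t • x)) ?_
    simp only [tailSup_smul]
    exact (tendsto_tailSup hK x).const_mul _
  · exact le_of_tendsto_of_tendsto' (tendsto_tailSup hK (x + y))
      ((tendsto_tailSup hK x).add (tendsto_tailSup hK y)) fun n => tailSup_add_le hK n x y

theorem limitNorm_mulVec_le (i : Fin r) (x : Fin m → ℝ) :
    limitNorm B (B i *ᵥ x) ≤ limitNorm B x := by
  refine le_of_tendsto_of_tendsto' (tendsto_tailSup hK (B i *ᵥ x)) (tendsto_tailSup hK x)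
    fun n => tailSup_le (tailSup_nonneg _ _) fun l hl => ?_
  rw [← prod_map_append_singleton_mulVec]
  exact le_tailSup hK x (by rw [List.length_append]; omega)

theorem exists_limitNorm_le_mulVec (hr : 0 < r) (x : Fin m → ℝ) :
    ∃ i, limitNorm B x ≤ limitNorm B (B i *ᵥ x) := by
  have : Nonempty (Fin r) := ⟨⟨0, hr⟩⟩
  obtain ⟨i₀, hi₀⟩ := Finite.exists_max fun i => limitNorm B (B i *ᵥ x)
  refine ⟨i₀, le_of_forall_gt_imp_ge_of_dense fun a ha => ?_⟩
  have hev : ∀ᶠ n in atTop, ∀ i, tailSup B n (B i *ᵥ x) < a :=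
    eventually_all.2 fun i =>
      (tendsto_tailSup hK (B i *ᵥ x)).eventually_lt_const ((hi₀ i).trans_lt ha)
  obtain ⟨n, hn⟩ := hev.exists
  refine (limitNorm_le_tailSup (n + 1) x).trans
    (tailSup_le ((limitNorm_nonneg _).trans ha.le) fun l hl => ?_)
  obtain ⟨l', i, rfl⟩ : ∃ l' i, l = l' ++ [i] :=
    ⟨l.dropLast, l.getLast (by rintro rfl; simp at hl), (List.dropLast_append_getLast _).symm⟩
  rw [prod_map_append_singleton_mulVec]
  exact (le_tailSup hK _ (by simpa using hl)).trans (hn i).le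

theorem limitNorm_eq_zero_of_irreducible (hB : IsIrreducibleFamily B) {δ : ℝ} (hδ : 0 < δ)
    (hlow : ∀ n, ∃ l : List (Fin r), n ≤ l.length ∧ δ ≤ matNorm (l.map B).prod)
    {x : Fin m → ℝ} (hx : limitNorm B x = 0) : x = 0 := by
  obtain ⟨h0, hsmul, hadd⟩ := isSeminorm_limitNorm hK
  let W : Submodule ℝ (Fin m → ℝ) :=
    { carrier := {x | limitNorm B x = 0}
      zero_mem' := by simpa using hsmul 0 0
      add_mem' := fun {x y} (hx : _ = _) (hy : _ = _) => le_antisymm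
        ((hadd x y).trans_eq (by rw [hx, hy, add_zero])) (h0 _)
      smul_mem' := fun t x (hx : _ = _) => (hsmul t x).trans (by rw [hx, mul_zero]) }
  have hinv : ∀ i, ∀ x ∈ W, (B i).mulVec x ∈ W := fun i x hx =>
    le_antisymm ((limitNorm_mulVec_le hK i x).trans_eq hx) (h0 _)
  rcases hB W hinv with hW | hW
  · have : x ∈ W := hx
    rwa [hW, Submodule.mem_bot] at this
  exfalso
  set ε : ℝ := δ / (m + 1)
  have hε : 0 < ε := by positivity
  have hev : ∀ᶠ n in atTop, ∀ j, tailSup B n (Pi.single j 1) < ε := by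
    refine eventually_all.2 fun j => (tendsto_tailSup hK _).eventually_lt_const ?_
    have hj : (Pi.single j 1 : Fin m → ℝ) ∈ W := hW ▸ Submodule.mem_top
    exact Eq.trans_lt hj hε
  obtain ⟨n, hn⟩ := hev.exists
  obtain ⟨l, hl, hδl⟩ := hlow n
  have h1 : matNorm (l.map B).prod ≤ m * ε := by
    refine matNorm_le_of_entry_le hε.le fun i j => ?_
    have h2 := (le_tailSup hK (Pi.single j 1) hl).trans (hn j).le
    rw [Matrix.mulVec_single_one] at h2
    exact (norm_le_pi_norm ((l.map B).prod.col j) i).trans h2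
  have h2 : (m + 1) * ε = δ := mul_div_cancel₀ _ (by positivity)
  linarith

end ProductBounded

/-- Existence of an extremal norm that is attained in every direction. -/
theorem exists_invariant_norm (hm : 0 < m) (hr : 0 < r) (hB : IsIrreducibleFamily B)
    (hgrowth : ∀ t : ℝ, 1 < t →
      ∃ C : ℝ, ∀ l : List (Fin r), matNorm (l.map B).prod ≤ C * t ^ l.length)
    {δ : ℝ} (hδ : 0 < δ)
    (hlow : ∀ n, ∃ l : List (Fin r), n ≤ l.length ∧ δ ≤ matNorm (l.map B).prod) :
    ∃ N : (Fin m → ℝ) → ℝ, IsNorm N ∧ (∀ i x, N (B i *ᵥ x) ≤ N x) ∧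
      ∀ x, ∃ i, N x ≤ N (B i *ᵥ x) := by
  obtain ⟨K, hK⟩ := exists_matNorm_prod_le_of_irreducible hm hB hgrowth
  obtain ⟨h0, hsmul, hadd⟩ := isSeminorm_limitNorm hK
  exact ⟨limitNorm B, ⟨h0, fun _ => limitNorm_eq_zero_of_irreducible hK hB hδ hlow, hsmul, hadd⟩,
    limitNorm_mulVec_le hK, exists_limitNorm_le_mulVec hK hr⟩

end InvariantNorm

section ConvexHull

variable {E : Type*} [AddCommGroup E] [Module ℝ E] [TopologicalSpace E] [ContinuousAdd E]
  [ContinuousSMul ℝ E]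

theorem IsCompact.convexJoin {s t : Set E} (hs : IsCompact s) (ht : IsCompact t) :
    IsCompact (_root_.convexJoin ℝ s t) := by
  have himage : _root_.convexJoin ℝ s t = (fun p : ℝ × E × E => (1 - p.1) • p.2.1 + p.1 • p.2.2) ''
      (Set.Icc 0 1 ×ˢ s ×ˢ t) := by
    ext x
    simp only [mem_convexJoin, segment_eq_image, Set.mem_image, Set.mem_prod, Prod.exists]
    constructor
    · rintro ⟨a, ha, b, hb, θ, hθ, rfl⟩
      exact ⟨θ, a, b, ⟨hθ, ha, hb⟩, rfl⟩
    · rintro ⟨θ, a, b, ⟨hθ, ha, hb⟩, rfl⟩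
      exact ⟨a, ha, b, hb, θ, hθ, rfl⟩
  rw [himage]
  exact (isCompact_Icc.prod (hs.prod ht)).image (by fun_prop)

theorem isCompact_convexHull_biUnion {ι : Type*} {K : ι → Set E} (s : Finset ι)
    (hcomp : ∀ i, IsCompact (K i)) (hconv : ∀ i, Convex ℝ (K i)) (hne : ∀ i, (K i).Nonempty) :
    IsCompact (convexHull ℝ (⋃ i ∈ s, K i)) := by
  classical
  induction s using Finset.induction_on with
  | empty => simp
  | insert i s _ ih =>
    rw [Finset.set_biUnion_insert]
    rcases s.eq_empty_or_nonempty with rfl | ⟨j, hj⟩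
    · simpa [(hconv i).convexHull_eq] using hcomp i
    have hne' : (convexHull ℝ (⋃ i ∈ s, K i)).Nonempty :=
      ((hne j).mono (Set.subset_biUnion_of_mem (u := K) hj)).convexHull
    rw [← convexHull_convexHull_union_right,
      (hconv i).convexHull_union (convex_convexHull ℝ _) (hne i) hne']
    exact (hcomp i).convexJoin ih

end ConvexHull

section PolarBody

variable {m r : ℕ}

theorem mulVec_dotProduct_eq (M : Matrix (Fin m) (Fin m) ℝ) (x y : Fin m → ℝ) :
    (M *ᵥ x) ⬝ᵥ y = x ⬝ᵥ (Mᵀ *ᵥ y) := by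
  rw [dotProduct_comm, Matrix.dotProduct_mulVec, Matrix.mulVec_transpose, dotProduct_comm]

theorem exists_eq_dotProduct (f : (Fin m → ℝ) →ₗ[ℝ] ℝ) :
    ∃ y : Fin m → ℝ, ∀ x, f x = x ⬝ᵥ y := by
  refine ⟨fun j => f (Pi.single j 1), fun x => ?_⟩
  rw [LinearMap.pi_apply_eq_sum_univ f x]
  simp only [dotProduct, smul_eq_mul]
  refine Finset.sum_congr rfl fun j _ => ?_
  congr 2
  ext k
  simp [Pi.single_apply, eq_comm]

theorem IsNorm.exists_le_mul_norm {N : (Fin m → ℝ) → ℝ} (hN : IsNorm N) :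
    ∃ C : ℝ, 0 ≤ C ∧ ∀ x, N x ≤ C * ‖x‖ := by
  obtain ⟨h0, -, hsmul, hadd⟩ := hN
  refine ⟨∑ j, N (Pi.single j 1), Finset.sum_nonneg fun j _ => h0 _, fun x => ?_⟩
  have hzero : N 0 = 0 := by simpa using hsmul 0 0
  have hx : x = ∑ j, x j • (Pi.single j 1 : Fin m → ℝ) := by
    ext k
    simp [Pi.single_apply]
  calc N x = N (∑ j, x j • (Pi.single j 1 : Fin m → ℝ)) := by rw [← hx]
    _ ≤ ∑ j, N (x j • (Pi.single j 1 : Fin m → ℝ)) :=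
        Finset.le_sum_of_subadditive N hzero.le hadd _ _
    _ ≤ ∑ j, N (Pi.single j 1) * ‖x‖ := by
        refine Finset.sum_le_sum fun j _ => ?_
        rw [hsmul, mul_comm]
        exact mul_le_mul_of_nonneg_left (norm_le_pi_norm x j) (h0 _)
    _ = _ := by rw [Finset.sum_mul]

theorem IsNorm.continuous {N : (Fin m → ℝ) → ℝ} (hN : IsNorm N) : Continuous N := by
  obtain ⟨C, hC0, hC⟩ := hN.exists_le_mul_norm
  obtain ⟨-, -, -, hadd⟩ := hN
  refine (LipschitzWith.of_le_add_mul ⟨C, hC0⟩ fun x y => ?_).continuous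
  rw [dist_eq_norm]
  calc N x = N (y + (x - y)) := by rw [add_sub_cancel]
    _ ≤ N y + C * ‖x - y‖ := (hadd _ _).trans (add_le_add_right (hC _) _)

theorem IsNorm.exists_mul_norm_le {N : (Fin m → ℝ) → ℝ} (hN : IsNorm N) :
    ∃ c : ℝ, 0 < c ∧ ∀ x, c * ‖x‖ ≤ N x := by
  have hcont := hN.continuous
  obtain ⟨h0, hdef, hsmul, -⟩ := hN
  rcases (Metric.sphere (0 : Fin m → ℝ) 1).eq_empty_or_nonempty with he | hne
  · refine ⟨1, one_pos, fun x => ?_⟩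
    have hx : x = 0 := by
      by_contra hx
      have : ‖x‖⁻¹ • x ∈ Metric.sphere (0 : Fin m → ℝ) 1 := by simp [norm_smul, hx]
      simp [he] at this
    simpa [hx] using h0 0
  obtain ⟨z, hz, hmin⟩ := (isCompact_sphere (0 : Fin m → ℝ) 1).exists_isMinOn hne
    hcont.continuousOn
  have hz0 : z ≠ 0 := by rintro rfl; simp at hz
  refine ⟨N z, (h0 z).lt_of_ne fun h => hz0 (hdef z h.symm), fun x => ?_⟩
  rcases eq_or_ne x 0 with rfl | hx
  · simpa using h0 0
  have hx' : 0 < ‖x‖ := norm_pos_iff.2 hx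
  have h1 : N z ≤ N (‖x‖⁻¹ • x) := hmin (by simp [norm_smul, hx])
  rw [hsmul, abs_of_pos (inv_pos.2 hx'), inv_mul_eq_div, le_div_iff₀ hx'] at h1
  exact h1

/-- The convex body whose support function is `N`. -/
def polarBody (N : (Fin m → ℝ) → ℝ) : Set (Fin m → ℝ) := {x | ∀ y, x ⬝ᵥ y ≤ N y}

variable {N : (Fin m → ℝ) → ℝ}

theorem mem_polarBody {x : Fin m → ℝ} : x ∈ polarBody N ↔ ∀ y, x ⬝ᵥ y ≤ N y := Iff.rfl

theorem IsNorm.map_neg (hN : IsNorm N) (x : Fin m → ℝ) : N (-x) = N x := by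
  simpa using hN.2.2.1 (-1) x

theorem polarBody_eq_neg (hN : IsNorm N) : polarBody N = -polarBody N := by
  have h : ∀ x ∈ polarBody N, -x ∈ polarBody N := fun x hx y => by
    rw [neg_dotProduct, ← dotProduct_neg, ← hN.map_neg]
    exact hx _
  ext x
  exact ⟨h x, fun hx => neg_neg x ▸ h _ hx⟩

theorem convex_polarBody : Convex ℝ (polarBody N) := by
  intro x hx z hz a b ha hb hab y
  rw [add_dotProduct, smul_dotProduct, smul_dotProduct, smul_eq_mul, smul_eq_mul]
  calc a * (x ⬝ᵥ y) + b * (z ⬝ᵥ y) ≤ a * N y + b * N y :=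
        add_le_add (mul_le_mul_of_nonneg_left (hx y) ha) (mul_le_mul_of_nonneg_left (hz y) hb)
    _ = N y := by rw [← add_mul, hab, one_mul]

theorem isCompact_polarBody (hN : IsNorm N) : IsCompact (polarBody N) := by
  refine Metric.isCompact_of_isClosed_isBounded ?_ ?_
  · have : polarBody N = ⋂ y, {x | x ⬝ᵥ y ≤ N y} := by ext x; simp [mem_polarBody]
    rw [this]
    exact isClosed_iInter fun y =>
      isClosed_le (Continuous.dotProduct continuous_id continuous_const) continuous_const
  · refine (Metric.isBounded_closedBall (x := (0 : Fin m → ℝ))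
      (r := ∑ j, N (Pi.single j 1))).subset fun x hx => ?_
    have hnn : ∀ j ∈ Finset.univ, 0 ≤ N (Pi.single j 1) := fun j _ => hN.1 _
    rw [mem_closedBall_zero_iff, pi_norm_le_iff_of_nonneg (Finset.sum_nonneg hnn)]
    refine fun j => le_trans ?_ (Finset.single_le_sum hnn (Finset.mem_univ j))
    have h1 := hx (Pi.single j 1)
    have h2 := hx (-Pi.single j 1)
    rw [hN.map_neg, dotProduct_neg] at h2
    rw [dotProduct_single_one] at h1 h2
    exact abs_le.2 ⟨by linarith, h1⟩

theorem nonempty_interior_polarBody (hN : IsNorm N) : (interior (polarBody N)).Nonempty := by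
  obtain ⟨c, hc, hcN⟩ := hN.exists_mul_norm_le
  refine ⟨0, mem_interior.2 ⟨Metric.ball 0 (c / (m + 1)), fun x hx y => ?_, Metric.isOpen_ball,
    Metric.mem_ball_self (by positivity)⟩⟩
  rw [mem_ball_zero_iff, lt_div_iff₀ (by positivity)] at hx
  refine ((le_abs_self _).trans (abs_dotProduct_le x y)).trans (le_trans ?_ (hcN y))
  refine mul_le_mul_of_nonneg_right ?_ (norm_nonneg y)
  nlinarith [norm_nonneg x]

/-- Every linear functional attains the value `N` on the polar body of a norm. -/
theorem exists_mem_polarBody_dotProduct_eq (hN : IsNorm N) (z : Fin m → ℝ) :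
    ∃ s ∈ polarBody N, s ⬝ᵥ z = N z := by
  have hpos : ∀ c : ℝ, 0 < c → ∀ x, N (c • x) = c * N x := fun c hc x => by
    rw [hN.2.2.1, abs_of_pos hc]
  have hzero : N 0 = 0 := by simpa using hN.2.2.1 0 0
  obtain ⟨g, hg, hgN⟩ : ∃ g : (Fin m → ℝ) →ₗ[ℝ] ℝ, g z = N z ∧ ∀ x, g x ≤ N x := by
    rcases eq_or_ne z 0 with rfl | hz
    · exact ⟨0, by simp [hzero], fun x => hN.1 x⟩
    obtain ⟨g, hg, hgN⟩ := exists_extension_of_le_sublinear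
      (LinearPMap.mkSpanSingleton z (N z) hz) N hpos hN.2.2.2 (by
        rintro ⟨x, hx⟩
        obtain ⟨t, rfl⟩ := Submodule.mem_span_singleton.1 hx
        refine (LinearPMap.mkSpanSingleton'_apply z (N z) _ t hx).trans_le ?_
        rw [RingHom.id_apply, smul_eq_mul, hN.2.2.1]
        exact mul_le_mul_of_nonneg_right (le_abs_self t) (hN.1 z))
    refine ⟨g, ?_, hgN⟩
    have hgz := hg ⟨z, Submodule.mem_span_singleton_self z⟩
    exact hgz.trans (LinearPMap.mkSpanSingleton'_apply_self z (N z) _ _)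
  obtain ⟨s, hs⟩ := exists_eq_dotProduct g
  refine ⟨s, fun y => ?_, ?_⟩
  · rw [dotProduct_comm, ← hs]
    exact hgN y
  · rw [dotProduct_comm, ← hs, hg]

theorem smul_polarBody_eq_convexHull {A : Fin r → Matrix (Fin m) (Fin m) ℝ} {ρ : ℝ} (hρ : 0 < ρ)
    (hN : IsNorm N) (hle : ∀ i y, N ((A i)ᵀ *ᵥ y) ≤ ρ * N y)
    (hge : ∀ y, ∃ i, ρ * N y ≤ N ((A i)ᵀ *ᵥ y)) :
    ρ • polarBody N = convexHull ℝ (⋃ i : Fin r, (A i).mulVec '' polarBody N) := by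
  have hcomp := isCompact_polarBody hN
  refine Set.Subset.antisymm ?_
    (convexHull_min (Set.iUnion_subset fun i => ?_) (convex_polarBody.smul ρ))
  · have hclosed : IsClosed (convexHull ℝ (⋃ i : Fin r, (A i).mulVec '' polarBody N)) := by
      have h := isCompact_convexHull_biUnion (K := fun i => (A i).mulVec '' polarBody N)
        Finset.univ
        (fun i => hcomp.image (Continuous.matrix_mulVec continuous_const continuous_id))
        (fun i => convex_polarBody.linear_image (A i).mulVecLin)
        (fun i => ((nonempty_interior_polarBody hN).mono interior_subset).image _)
      simp only [Finset.mem_univ, Set.iUnion_true] at h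
      exact h.isClosed
    rintro _ ⟨x, hx, rfl⟩
    by_contra hcon
    obtain ⟨f, u, hfu, hux⟩ := geometric_hahn_banach_closed_point (convex_convexHull ℝ _)
      hclosed hcon
    obtain ⟨y, hy⟩ := exists_eq_dotProduct f.toLinearMap
    obtain ⟨i, hi⟩ := hge y
    obtain ⟨s, hs, hsy⟩ := exists_mem_polarBody_dotProduct_eq hN ((A i)ᵀ *ᵥ y)
    have h1 : (A i *ᵥ s) ⬝ᵥ y < u := by
      rw [← hy]
      exact hfu _ (subset_convexHull ℝ _ (Set.mem_iUnion.2 ⟨i, s, hs, rfl⟩))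
    rw [mulVec_dotProduct_eq, hsy] at h1
    have h2 : u < (ρ • x) ⬝ᵥ y := by
      rw [← hy]
      exact hux
    rw [smul_dotProduct, smul_eq_mul] at h2
    have h3 := mul_le_mul_of_nonneg_left (hx y) hρ.le
    linarith
  · rintro _ ⟨x, hx, rfl⟩
    rw [Set.mem_smul_set_iff_inv_smul_mem₀ hρ.ne']
    intro y
    rw [smul_dotProduct, smul_eq_mul, inv_mul_le_iff₀ hρ, mulVec_dotProduct_eq]
    exact (hx _).trans (hle i y)

end PolarBody

section ExtremalBody

variable {m r : ℕ} {A : Fin r → Matrix (Fin m) (Fin m) ℝ} {ρ : ℝ}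

theorem IsIrreducibleFamily.smul_transpose (hA : IsIrreducibleFamily A) {t : ℝ} (ht : t ≠ 0) :
    IsIrreducibleFamily fun i => t • (A i)ᵀ := by
  intro W hW
  let W' : Submodule ℝ (Fin m → ℝ) :=
    { carrier := {x | ∀ w ∈ W, x ⬝ᵥ w = 0}
      zero_mem' := fun w _ => zero_dotProduct w
      add_mem' := fun {x y} hx hy w hw => by rw [add_dotProduct, hx w hw, hy w hw, add_zero]
      smul_mem' := fun c x hx w hw => by rw [smul_dotProduct, hx w hw, smul_zero] }
  have hW' : ∀ i, ∀ x ∈ W', (A i).mulVec x ∈ W' := fun i x hx w hw => by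
    have h := hx _ (hW i w hw)
    rw [Matrix.smul_mulVec, dotProduct_smul, smul_eq_mul] at h
    rw [mulVec_dotProduct_eq]
    exact (mul_eq_zero.1 h).resolve_left ht
  rcases hA W' hW' with h | h
  · refine Or.inr (by_contra fun hne => ?_)
    obtain ⟨f, hf, hker⟩ := W.exists_le_ker_of_lt_top (lt_top_iff_ne_top.2 hne)
    obtain ⟨y, hy⟩ := exists_eq_dotProduct f
    have hyW : y ∈ W' := fun w hw => by
      rw [dotProduct_comm, ← hy]
      exact hker hw
    rw [h, Submodule.mem_bot] at hyW
    exact hf (LinearMap.ext fun x => by simp [hy, hyW])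
  · refine Or.inl ((Submodule.eq_bot_iff _).2 fun w hw => ?_)
    have hwW : w ∈ W' := h ▸ Submodule.mem_top
    exact dotProduct_self_eq_zero.1 (hwW w hw)

theorem prod_map_smul_transpose (t : ℝ) (l : List (Fin r)) :
    (l.map fun i => t • (A i)ᵀ).prod = t ^ l.length • ((l.reverse.map A).prod)ᵀ := by
  induction l with
  | nil => simp
  | cons i l ih =>
    rw [List.map_cons, List.prod_cons, ih, List.reverse_cons, List.map_append, List.prod_append,
      Matrix.transpose_mul, List.length_cons, pow_succ]
    simp [smul_smul]

theorem exists_extremal_body (hm : 0 < m) (hr : 0 < r) (hA : IsIrreducibleFamily A)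
    (hρ : 0 < ρ) (hjsr : ρ = jsr A) :
    ∃ S : Set (Fin m → ℝ), S = -S ∧ IsCompact S ∧ Convex ℝ S ∧ (interior S).Nonempty ∧
      ρ • S = convexHull ℝ (⋃ i : Fin r, (A i).mulVec '' S) := by
  set B : Fin r → Matrix (Fin m) (Fin m) ℝ := fun i => ρ⁻¹ • (A i)ᵀ
  have hm' : (0 : ℝ) < m := Nat.cast_pos.2 hm
  have hgrowth : ∀ t : ℝ, 1 < t →
      ∃ C : ℝ, ∀ l : List (Fin r), matNorm (l.map B).prod ≤ C * t ^ l.length := by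
    intro t ht
    obtain ⟨C, -, hC⟩ := exists_matNorm_prod_le_of_jsr_lt (A := A) (t := ρ * t) (by positivity)
      (hjsr ▸ lt_mul_of_one_lt_right hρ ht)
    refine ⟨m * C, fun l => ?_⟩
    have h := hC l.reverse
    rw [List.length_reverse, mul_pow] at h
    rw [prod_map_smul_transpose]
    calc matNorm (ρ⁻¹ ^ l.length • ((l.reverse.map A).prod)ᵀ)
        ≤ ρ⁻¹ ^ l.length * (m * matNorm (l.reverse.map A).prod) := by
          refine (matNorm_smul_le _ _).trans ?_
          rw [abs_of_pos (by positivity)]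
          exact mul_le_mul_of_nonneg_left (matNorm_transpose_le _) (by positivity)
      _ ≤ ρ⁻¹ ^ l.length * (m * (C * (ρ ^ l.length * t ^ l.length))) := by gcongr
      _ = m * C * t ^ l.length := by
          rw [inv_pow]
          field_simp
  have hlow : ∀ n, ∃ l : List (Fin r), n ≤ l.length ∧ 1 / (2 * m) ≤ matNorm (l.map B).prod := by
    intro n
    by_contra! hcon
    refine (jsr_lt_of_matNorm_prod_lt (A := A) hρ (δ := 1 / 2) (by norm_num) (by norm_num)
      n.succ_ne_zero fun l hl => ?_).ne' hjsr
    have h := (hcon l.reverse (by rw [List.length_reverse]; omega)).le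
    have hA' : (l.map A).prod = (ρ ^ l.length • (l.reverse.map B).prod)ᵀ := by
      rw [prod_map_smul_transpose, List.length_reverse, List.reverse_reverse, smul_smul,
        ← mul_pow, mul_inv_cancel₀ hρ.ne', one_pow, one_smul, Matrix.transpose_transpose]
    rw [hA', ← hl]
    calc matNorm (ρ ^ l.length • (l.reverse.map B).prod)ᵀ
        ≤ m * (ρ ^ l.length * matNorm (l.reverse.map B).prod) := by
          refine (matNorm_transpose_le _).trans (mul_le_mul_of_nonneg_left ?_ hm'.le)
          exact (matNorm_smul_le _ _).trans_eq (by rw [abs_of_pos (by positivity)])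
      _ ≤ m * (ρ ^ l.length * (1 / (2 * m))) := by gcongr
      _ = 1 / 2 * ρ ^ l.length := by field_simp
  obtain ⟨N, hN, hle, hge⟩ := exists_invariant_norm hm hr
    (hA.smul_transpose (inv_ne_zero hρ.ne')) hgrowth (by positivity) hlow
  have hB : ∀ i y, N (B i *ᵥ y) = ρ⁻¹ * N ((A i)ᵀ *ᵥ y) := fun i y => by
    rw [Matrix.smul_mulVec, hN.2.2.1, abs_of_pos (inv_pos.2 hρ)]
  refine ⟨polarBody N, polarBody_eq_neg hN, isCompact_polarBody hN, convex_polarBody,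
    nonempty_interior_polarBody hN, smul_polarBody_eq_convexHull hρ hN (fun i y => ?_) fun y => ?_⟩
  · have h := hle i y
    rwa [hB, inv_mul_le_iff₀ hρ] at h
  · obtain ⟨i, hi⟩ := hge y
    rw [hB, le_inv_mul_iff₀ hρ] at hi
    exact ⟨i, hi⟩

theorem exists_closedBall_subset_of_symmetric {S : Set (Fin m → ℝ)} (hsymm : S = -S)
    (hconv : Convex ℝ S) (hint : (interior S).Nonempty) :
    ∃ c : ℝ, 0 < c ∧ Metric.closedBall 0 c ⊆ S := by
  obtain ⟨x, hx⟩ := hint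
  have hx' : -x ∈ interior S := by
    rw [hsymm] at hx
    exact ((Homeomorph.neg (Fin m → ℝ)).preimage_interior S).symm.subset hx
  have h0 : (0 : Fin m → ℝ) ∈ interior S := by
    have := hconv.interior hx hx' (a := 1 / 2) (b := 1 / 2) (by norm_num) (by norm_num)
      (by norm_num)
    simpa using this
  exact Metric.nhds_basis_closedBall.mem_iff.1 (mem_interior_iff_mem_nhds.1 h0)

variable {S : Set (Fin m → ℝ)}

theorem prod_mulVec_mem_smul (hS : ρ • S = convexHull ℝ (⋃ i : Fin r, (A i).mulVec '' S))
    (l : List (Fin r)) {x : Fin m → ℝ} (hx : x ∈ S) :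
    (l.map A).prod *ᵥ x ∈ ρ ^ l.length • S := by
  induction l with
  | nil => simpa using hx
  | cons i l ih =>
    obtain ⟨s, hs, hsx⟩ := ih
    have h1 : A i *ᵥ s ∈ ρ • S :=
      hS ▸ subset_convexHull ℝ _ (Set.mem_iUnion.2 ⟨i, s, hs, rfl⟩)
    rw [List.map_cons, List.prod_cons, ← Matrix.mulVec_mulVec, ← hsx, List.length_cons, pow_succ,
      mul_smul]
    simp only [Matrix.mulVec_smul]
    exact Set.smul_mem_smul_set h1

theorem pow_smul_subset_of_prod_mulVec_mem
    (hS : ρ • S = convexHull ℝ (⋃ i : Fin r, (A i).mulVec '' S)) (n : ℕ)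
    {T : Set (Fin m → ℝ)} (hT : Convex ℝ T)
    (h : ∀ l : List (Fin r), l.length = n → ∀ x ∈ S, (l.map A).prod *ᵥ x ∈ T) :
    ρ ^ n • S ⊆ T := by
  induction n generalizing T with
  | zero =>
    rw [pow_zero, one_smul]
    intro x hx
    simpa using h [] rfl x hx
  | succ n ih =>
    have hi : ∀ i, ρ ^ n • S ⊆ (A i).mulVecLin ⁻¹' T := fun i =>
      ih (hT.linear_preimage (A i).mulVecLin) fun l hl x hx => by
        have := h (i :: l) (by rw [List.length_cons, hl]) x hx
        rwa [List.map_cons, List.prod_cons, ← Matrix.mulVec_mulVec] at this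
    have hsub : ρ • S ⊆ (LinearMap.lsmul ℝ (Fin m → ℝ) (ρ ^ n)) ⁻¹' T := by
      rw [hS]
      refine convexHull_min (Set.iUnion_subset fun i => ?_) (hT.linear_preimage _)
      rintro _ ⟨x, hx, rfl⟩
      have := hi i (Set.smul_mem_smul_set hx)
      rw [Set.mem_preimage, Matrix.mulVecLin_apply, Matrix.mulVec_smul] at this
      exact this
    rw [pow_succ, mul_smul]
    rintro _ ⟨x, hx, rfl⟩
    exact hsub hx

theorem eq_jsr_of_extremal_body (hm : 0 < m) (hρ : 0 < ρ) (hsymm : S = -S) (hcomp : IsCompact S)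
    (hconv : Convex ℝ S) (hint : (interior S).Nonempty)
    (hS : ρ • S = convexHull ℝ (⋃ i : Fin r, (A i).mulVec '' S)) : ρ = jsr A := by
  obtain ⟨c, hc, hcS⟩ := exists_closedBall_subset_of_symmetric hsymm hconv hint
  obtain ⟨D, hD, hSD⟩ := hcomp.isBounded.exists_pos_norm_le
  refine le_antisymm (le_jsr_of_le_matNorm_prod (c := c / (2 * D)) (by positivity) hρ.le
    fun n => ?_) (jsr_le_of_matNorm_prod_le (C := D / c) (by positivity) hρ.le fun l => ?_)
  · by_contra! hcon
    have hball : ρ ^ n • S ⊆ Metric.closedBall 0 (c / 2 * ρ ^ n) := by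
      refine pow_smul_subset_of_prod_mulVec_mem hS n (convex_closedBall 0 _) fun l hl x hx => ?_
      rw [mem_closedBall_zero_iff]
      calc ‖(l.map A).prod *ᵥ x‖ ≤ matNorm (l.map A).prod * ‖x‖ := norm_mulVec_le_matNorm _ _
        _ ≤ c / (2 * D) * ρ ^ n * D :=
            mul_le_mul (hcon l hl).le (hSD x hx) (norm_nonneg _) (by positivity)
        _ = c / 2 * ρ ^ n := by field_simp
    have hx : (Pi.single ⟨0, hm⟩ c : Fin m → ℝ) ∈ S := hcS (by
      rw [mem_closedBall_zero_iff, Pi.norm_single, Real.norm_of_nonneg hc.le])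
    have h := hball (Set.smul_mem_smul_set hx)
    rw [mem_closedBall_zero_iff, norm_smul, Pi.norm_single, Real.norm_of_nonneg hc.le,
      Real.norm_of_nonneg (by positivity)] at h
    have : 0 < c * ρ ^ n := by positivity
    linarith
  · refine matNorm_le (by positivity) fun x => ?_
    rcases eq_or_ne x 0 with rfl | hx
    · simp
    have hx' : 0 < ‖x‖ := norm_pos_iff.2 hx
    have hmem : (c / ‖x‖) • x ∈ S := hcS (by
      rw [mem_closedBall_zero_iff, norm_smul, Real.norm_of_nonneg (by positivity),
        div_mul_cancel₀ _ hx'.ne'])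
    obtain ⟨s, hs, hsx⟩ := prod_mulVec_mem_smul hS l hmem
    have h := congrArg norm hsx
    simp only [Matrix.mulVec_smul, norm_smul] at h
    rw [Real.norm_of_nonneg (by positivity), Real.norm_of_nonneg (by positivity)] at h
    have h2 : c / ‖x‖ * ‖(l.map A).prod *ᵥ x‖ ≤ ρ ^ l.length * D :=
      h ▸ mul_le_mul_of_nonneg_left (hSD s hs) (by positivity)
    rw [div_mul_eq_mul_div, div_le_iff₀ hx'] at h2
    rw [div_mul_eq_mul_div, div_mul_eq_mul_div, le_div_iff₀ hc]
    linarith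

end ExtremalBody

/-- Dranishnikov–Konyagin–Protasov: for an irreducible family and `ρ > 0`,
`ρ = ρ(𝒜)` iff there is a centrally symmetric compact convex set `S` with nonempty interior
such that `ρ·S = conv(∪ᵢ Aᵢ(S))`. -/
theorem stmt17 {m r : ℕ} (hm : 2 ≤ m) (hr : 1 ≤ r)
    (A : Fin r → Matrix (Fin m) (Fin m) ℝ) (hA : IsIrreducibleFamily A)
    (ρ : ℝ) (hρ : 0 < ρ) :
    ρ = jsr A ↔
      ∃ S : Set (Fin m → ℝ), S = -S ∧ IsCompact S ∧ Convex ℝ S ∧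
        (interior S).Nonempty ∧
        ρ • S = convexHull ℝ (⋃ i : Fin r, (A i).mulVec '' S) := by
  constructor
  · exact exists_extremal_body (by omega) (by omega) hA hρ
  · rintro ⟨S, hsymm, hcomp, hconv, hint, hS⟩
    exact eq_jsr_of_extremal_body (by omega) hρ hsymm hcomp hconv hint hS
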